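/- Let n be a positive integer and let f : [0,∞) → ℝ be a continuous function. Then lim_{ρ→0⁺} sinh^{1−n}(ρ) ∫_0^ρ f(r) sinh^{n−1}(r) (cosh ρ − cosh r)^{-1/2} dr = (1/√2) B(1/2, n/2) · f(0), where B denotes the Euler Beta function B(x,y) = Γ(x)Γ(y)/Γ(x+y). -/

import Mathlib

open Real Set Filter Topology intervalIntegral

lemma cosh_sub_cosh_eq_two_mul_sinh_mul_sinh (x y : ℝ) :
    cosh x - cosh y = 2 * (sinh ((x + y) / 2) * sinh ((x - y) / 2)) := by
  have hx : cosh x = cosh ((x + y) / 2 + (x - y) / 2) := by ring_nf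
  have hy : cosh y = cosh ((x + y) / 2 - (x - y) / 2) := by ring_nf
  rw [hx, hy, Real.cosh_add, Real.cosh_sub]
  ring

lemma sq_sub_sq_div_two_le_cosh_sub_cosh {x y : ℝ} (hy : 0 ≤ y) (hxy : y ≤ x) :
    (x ^ 2 - y ^ 2) / 2 ≤ cosh x - cosh y := by
  rw [cosh_sub_cosh_eq_two_mul_sinh_mul_sinh]
  have h₁ : (x + y) / 2 ≤ sinh ((x + y) / 2) := self_le_sinh_iff.2 (by linarith)
  have h₂ : (x - y) / 2 ≤ sinh ((x - y) / 2) := self_le_sinh_iff.2 (by linarith)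
  nlinarith [mul_le_mul h₁ h₂ (by linarith) (by linarith)]

lemma tendsto_sinh_mul_div (c : ℝ) :
    Tendsto (fun x : ℝ => sinh (x * c) / x) (𝓝[>] 0) (𝓝 c) := by
  have h : HasDerivAt (fun x : ℝ => sinh (x * c)) c 0 := by
    simpa using ((hasDerivAt_id (0 : ℝ)).mul_const c).sinh
  refine (h.tendsto_slope_zero_right).congr fun x => ?_
  simp [div_eq_inv_mul]

lemma tendsto_sinh_mul_div_sinh (c : ℝ) :
    Tendsto (fun x : ℝ => sinh (x * c) / sinh x) (𝓝[>] 0) (𝓝 c) := by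
  have h := (tendsto_sinh_mul_div c).div (tendsto_sinh_mul_div 1) one_ne_zero
  rw [div_one] at h
  refine h.congr' ?_
  filter_upwards [self_mem_nhdsWithin] with x hx
  simp only [Pi.div_apply, mul_one]
  exact div_div_div_cancel_right₀ (ne_of_gt hx) _ _

lemma tendsto_cosh_sub_cosh_mul_div_sq (c : ℝ) :
    Tendsto (fun x : ℝ => (cosh x - cosh (x * c)) / x ^ 2) (𝓝[>] 0) (𝓝 ((1 - c ^ 2) / 2)) := by
  have h := ((tendsto_sinh_mul_div ((1 + c) / 2)).mul
    (tendsto_sinh_mul_div ((1 - c) / 2))).const_mul 2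
  have hc : 2 * ((1 + c) / 2 * ((1 - c) / 2)) = (1 - c ^ 2) / 2 := by ring
  rw [hc] at h
  refine h.congr fun x => ?_
  rw [cosh_sub_cosh_eq_two_mul_sinh_mul_sinh, show (x + x * c) / 2 = x * ((1 + c) / 2) by ring,
    show (x - x * c) / 2 = x * ((1 - c) / 2) by ring]
  ring

lemma integral_rpow_mul_one_sub_rpow {a b : ℝ} (ha : 0 < a) (hb : 0 < b) :
    ∫ x in (0 : ℝ)..1, x ^ (a - 1) * (1 - x) ^ (b - 1) =
      Real.Gamma a * Real.Gamma b / Real.Gamma (a + b) := by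
  have h := ProbabilityTheory.beta_eq_betaIntegralReal a b ha hb
  rw [ProbabilityTheory.beta] at h
  rw [h, ← Complex.ofReal_re (∫ x in (0 : ℝ)..1, x ^ (a - 1) * (1 - x) ^ (b - 1)),
    ← intervalIntegral.integral_ofReal, Complex.betaIntegral]
  congr 1
  refine intervalIntegral.integral_congr fun x hx => ?_
  rw [uIcc_of_le zero_le_one] at hx
  have hx' : 0 ≤ 1 - x := by linarith [hx.2]
  simp only [Complex.ofReal_mul, Complex.ofReal_cpow hx.1, Complex.ofReal_cpow hx']
  push_cast
  rfl

lemma integral_eq_integral_two_mul_comp_sq (g : ℝ → ℝ) :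
    ∫ x in (0 : ℝ)..1, g x = ∫ t in (0 : ℝ)..1, 2 * t * g (t ^ 2) := by
  have himage : (fun t : ℝ => t ^ 2) '' Ioo 0 1 = Ioo 0 1 := by
    ext x
    constructor
    · rintro ⟨t, ht, rfl⟩
      exact ⟨pow_pos ht.1 2, pow_lt_one₀ ht.1.le ht.2 two_ne_zero⟩
    · intro hx
      exact ⟨√x, ⟨Real.sqrt_pos.2 hx.1, (Real.sqrt_lt' one_pos).2 (by simpa using hx.2)⟩,
        Real.sq_sqrt hx.1.le⟩
  have h := MeasureTheory.integral_image_eq_integral_abs_deriv_smul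
    (f := fun t : ℝ => t ^ 2) (f' := fun t => 2 * t) (s := Ioo 0 1) measurableSet_Ioo
    (fun t _ => by simpa using (hasDerivAt_pow 2 t).hasDerivWithinAt)
    (fun s hs t ht hst => (pow_left_inj₀ hs.1.le ht.1.le two_ne_zero).1 hst) g
  rw [himage] at h
  rw [intervalIntegral.integral_of_le zero_le_one, intervalIntegral.integral_of_le zero_le_one,
    MeasureTheory.integral_Ioc_eq_integral_Ioo, MeasureTheory.integral_Ioc_eq_integral_Ioo, h]
  refine MeasureTheory.setIntegral_congr_fun measurableSet_Ioo fun t ht => ?_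
  simp [abs_of_pos ht.1]

lemma integral_rpow_mul_half_one_sub_sq_rpow {a : ℝ} (ha : 0 < a) :
    ∫ t in (0 : ℝ)..1, t ^ (a - 1) * ((1 - t ^ 2) / 2) ^ (-(1 : ℝ) / 2) =
      1 / √2 * (Real.Gamma (1 / 2) * Real.Gamma (a / 2) / Real.Gamma (1 / 2 + a / 2)) := by
  rw [mul_comm (Real.Gamma (1 / 2)), add_comm (1 / 2 : ℝ),
    ← integral_rpow_mul_one_sub_rpow (half_pos ha) one_half_pos,
    integral_eq_integral_two_mul_comp_sq fun x => x ^ (a / 2 - 1) * (1 - x) ^ ((1 : ℝ) / 2 - 1),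
    ← intervalIntegral.integral_const_mul]
  rw [intervalIntegral.integral_of_le zero_le_one, intervalIntegral.integral_of_le zero_le_one]
  refine MeasureTheory.setIntegral_congr_fun measurableSet_Ioc fun t ht => ?_
  have ht' : 0 ≤ 1 - t ^ 2 := by nlinarith [ht.1, ht.2]
  have h2 : (2 : ℝ) ^ (-(1 : ℝ) / 2) = 1 / √2 := by
    rw [neg_div, Real.rpow_neg zero_le_two, ← Real.sqrt_eq_rpow, one_div]
  have hpow : t * (t ^ 2) ^ (a / 2 - 1) = t ^ (a - 1) := by
    rw [← Real.rpow_natCast t 2, ← Real.rpow_mul ht.1.le]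
    nth_rewrite 1 [← Real.rpow_one t]
    rw [← Real.rpow_add ht.1]
    congr 1
    push_cast
    ring
  have hs : √2 * √2 = 2 := Real.mul_self_sqrt zero_le_two
  rw [Real.div_rpow ht' zero_le_two, h2, ← hpow, show (1 / 2 - 1 : ℝ) = -1 / 2 by norm_num]
  generalize (t ^ 2) ^ (a / 2 - 1) = A, (1 - t ^ 2) ^ (-1 / 2 : ℝ) = B
  have hs₀ : √2 ≠ 0 := Real.sqrt_ne_zero'.2 zero_lt_two
  field_simp
  linear_combination t * A * B * hs

lemma sinh_rpow_mul_integral_eq {a ρ : ℝ} (hρ : 0 < ρ) (f : ℝ → ℝ) :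
    sinh ρ ^ (1 - a) * ∫ r in (0 : ℝ)..ρ,
        f r * sinh r ^ (a - 1) * (cosh ρ - cosh r) ^ (-(1 : ℝ) / 2) =
      ∫ t in (0 : ℝ)..1, f (ρ * t) * (sinh (ρ * t) / sinh ρ) ^ (a - 1) *
        ((cosh ρ - cosh (ρ * t)) / ρ ^ 2) ^ (-(1 : ℝ) / 2) := by
  have h := mul_integral_comp_mul_left (a := 0) (b := 1) (c := ρ)
    (f := fun r => f r * sinh r ^ (a - 1) * (cosh ρ - cosh r) ^ (-(1 : ℝ) / 2))
  rw [mul_zero, mul_one] at h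
  rw [← h, ← mul_assoc, ← intervalIntegral.integral_const_mul]
  refine intervalIntegral.integral_congr fun t ht => ?_
  rw [uIcc_of_le zero_le_one] at ht
  have hsinh : 0 < sinh ρ := sinh_pos_iff.2 hρ
  have hsinh' : 0 ≤ sinh (ρ * t) := sinh_nonneg_iff.2 (mul_nonneg hρ.le ht.1)
  have hle : ρ * t ≤ ρ := mul_le_of_le_one_right hρ.le ht.2
  have hcosh : 0 ≤ cosh ρ - cosh (ρ * t) := by
    refine le_trans ?_ (sq_sub_sq_div_two_le_cosh_sub_cosh (mul_nonneg hρ.le ht.1) hle)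
    nlinarith [mul_nonneg hρ.le ht.1]
  have hsq : (ρ ^ 2) ^ (-(1 : ℝ) / 2) = ρ⁻¹ := by
    rw [neg_div, Real.rpow_neg (sq_nonneg ρ), ← Real.sqrt_eq_rpow, Real.sqrt_sq hρ.le]
  have hneg : sinh ρ ^ (1 - a) = (sinh ρ ^ (a - 1))⁻¹ := by
    rw [← Real.rpow_neg hsinh.le, neg_sub]
  rw [Real.div_rpow hsinh' hsinh.le, Real.div_rpow hcosh (sq_nonneg ρ), hsq, hneg, div_inv_eq_mul]
  ring

lemma norm_rescaled_integrand_le {a ρ t M : ℝ} (ha : 1 ≤ a) (hρ : 0 < ρ) (ht₀ : 0 < t)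
    (ht₁ : t < 1) {f : ℝ → ℝ} (hM : |f (ρ * t)| ≤ M) :
    ‖f (ρ * t) * (sinh (ρ * t) / sinh ρ) ^ (a - 1) *
        ((cosh ρ - cosh (ρ * t)) / ρ ^ 2) ^ (-(1 : ℝ) / 2)‖ ≤
      M * ((1 - t) / 2) ^ (-(1 : ℝ) / 2) := by
  have hρt : 0 < ρ * t := mul_pos hρ ht₀
  have hle : ρ * t ≤ ρ := mul_le_of_le_one_right hρ.le ht₁.le
  have hsinh : 0 < sinh ρ := sinh_pos_iff.2 hρ
  have hratio₀ : 0 ≤ sinh (ρ * t) / sinh ρ := div_nonneg (sinh_nonneg_iff.2 hρt.le) hsinh.le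
  have hratio₁ : sinh (ρ * t) / sinh ρ ≤ 1 := (div_le_one hsinh).2 (sinh_le_sinh.2 hle)
  have hcosh : (1 - t) / 2 ≤ (cosh ρ - cosh (ρ * t)) / ρ ^ 2 := by
    rw [le_div_iff₀ (pow_pos hρ 2)]
    refine le_trans ?_ (sq_sub_sq_div_two_le_cosh_sub_cosh hρt.le hle)
    nlinarith [mul_nonneg (sq_nonneg ρ) (mul_nonneg ht₀.le (sub_nonneg.2 ht₁.le))]
  have hpos : 0 < (1 - t) / 2 := by linarith
  have h₁ := Real.rpow_nonneg hratio₀ (a - 1)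
  have h₂ := Real.rpow_nonneg (hpos.le.trans hcosh) (-(1 : ℝ) / 2)
  rw [norm_mul, norm_mul, Real.norm_eq_abs, Real.norm_of_nonneg h₁, Real.norm_of_nonneg h₂]
  refine mul_le_mul ?_ (Real.rpow_le_rpow_of_nonpos hpos hcosh (by norm_num)) h₂
    ((abs_nonneg _).trans hM)
  exact (mul_le_of_le_one_right (abs_nonneg _)
    (Real.rpow_le_one hratio₀ hratio₁ (by linarith))).trans hM

lemma intervalIntegrable_const_mul_half_one_sub_rpow (M : ℝ) :
    IntervalIntegrable (fun t : ℝ => M * ((1 - t) / 2) ^ (-(1 : ℝ) / 2))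
      MeasureTheory.volume 0 1 := by
  have h : IntervalIntegrable (fun t : ℝ => (1 - t) ^ (-(1 : ℝ) / 2))
      MeasureTheory.volume 0 1 := by
    simpa using ((intervalIntegrable_rpow' (a := 0) (b := 1)
      (by norm_num : (-1 : ℝ) < -1 / 2)).comp_sub_left 1).symm
  refine (h.const_mul (M / 2 ^ (-(1 : ℝ) / 2))).congr fun t ht => ?_
  rw [uIoc_of_le zero_le_one] at ht
  have ht' : 0 ≤ 1 - t := by linarith [ht.2]
  simp only [Real.div_rpow ht' zero_le_two]
  ring

/-- Delta-function limit of the hyperbolic integral transform: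
`lim_{ρ→0⁺} sinh^{1-n}(ρ) ∫_0^ρ f(r) sinh^{n-1}(r) (cosh ρ - cosh r)^{-1/2} dr
  = (1/√2) B(1/2, n/2) f(0)`, where `B(x,y) = Γ(x)Γ(y)/Γ(x+y)`. -/
theorem hyperbolic_delta_limit (n : ℕ) (hn : 0 < n) (f : ℝ → ℝ)
    (hf : ContinuousOn f (Set.Ici 0)) :
    Tendsto
      (fun ρ : ℝ => Real.sinh ρ ^ ((1 : ℝ) - n) *
        ∫ r in (0 : ℝ)..ρ,
          f r * Real.sinh r ^ ((n : ℝ) - 1) * (Real.cosh ρ - Real.cosh r) ^ (-(1 : ℝ) / 2))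
      (𝓝[>] 0)
      (𝓝 (1 / Real.sqrt 2 *
        (Real.Gamma (1 / 2) * Real.Gamma ((n : ℝ) / 2) /
          Real.Gamma (1 / 2 + (n : ℝ) / 2)) * f 0)) := by
  have hn₁ : (1 : ℝ) ≤ n := by exact_mod_cast hn
  obtain ⟨M, hM⟩ := isCompact_Icc.exists_bound_of_continuousOn
    (hf.mono (Icc_subset_Ici_self (a := (1 : ℝ)) (b := 0)))
  have hmem : ∀ᶠ ρ : ℝ in 𝓝[>] 0, ρ ∈ Ioo (0 : ℝ) 1 := Ioo_mem_nhdsGT one_pos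
  rw [← integral_rpow_mul_half_one_sub_sq_rpow (by linarith : (0 : ℝ) < n), mul_comm _ (f 0),
    ← intervalIntegral.integral_const_mul]
  refine Tendsto.congr' (hmem.mono fun ρ hρ => (sinh_rpow_mul_integral_eq hρ.1 f).symm) ?_
  refine intervalIntegral.tendsto_integral_filter_of_dominated_convergence
    (fun t => M * ((1 - t) / 2) ^ (-(1 : ℝ) / 2)) ?_ ?_
    (intervalIntegrable_const_mul_half_one_sub_rpow M) ?_
  · filter_upwards [hmem] with ρ hρ
    rw [uIoc_of_le zero_le_one]
    have hfρ : ContinuousOn (fun t => f (ρ * t)) (Ioc 0 1) :=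
      hf.comp (by fun_prop) fun t ht => mul_nonneg hρ.1.le ht.1.le
    refine ((hfρ.aestronglyMeasurable measurableSet_Ioc).mul ?_).mul ?_
    · exact Measurable.aestronglyMeasurable (by fun_prop)
    · exact Measurable.aestronglyMeasurable (by fun_prop)
  · filter_upwards [hmem] with ρ hρ
    filter_upwards [MeasureTheory.Measure.ae_ne MeasureTheory.volume (1 : ℝ)] with t ht1 ht
    rw [uIoc_of_le zero_le_one] at ht
    exact norm_rescaled_integrand_le hn₁ hρ.1 ht.1 (lt_of_le_of_ne ht.2 ht1)
      (hM _ ⟨mul_nonneg hρ.1.le ht.1.le, mul_le_one₀ hρ.2.le ht.1.le ht.2⟩)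
  · filter_upwards [MeasureTheory.Measure.ae_ne MeasureTheory.volume (1 : ℝ)] with t ht1 ht
    rw [uIoc_of_le zero_le_one] at ht
    have ht' : 0 < (1 - t ^ 2) / 2 := by nlinarith [ht.1, lt_of_le_of_ne ht.2 ht1]
    have hzero : Tendsto (fun ρ : ℝ => ρ * t) (𝓝[>] 0) (𝓝[≥] 0) := by
      refine tendsto_nhdsWithin_iff.2 ⟨?_, hmem.mono fun ρ hρ => mul_nonneg hρ.1.le ht.1.le⟩
      have h : Continuous fun ρ : ℝ => ρ * t := by fun_prop
      simpa using h.tendsto' 0 0 (zero_mul t) |>.mono_left nhdsWithin_le_nhds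
    have hfzero : Tendsto f (𝓝[≥] 0) (𝓝 (f 0)) := hf 0 self_mem_Ici
    rw [← mul_assoc]
    exact ((hfzero.comp hzero).mul
      ((tendsto_sinh_mul_div_sinh t).rpow_const (Or.inl ht.1.ne'))).mul
      ((tendsto_cosh_sub_cosh_mul_div_sq t).rpow_const (Or.inl ht'.ne'))
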